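/- arXiv:1102.0406 — 3 statements merged into one kernel-verified Lean document; each statement's English description precedes it below -/
import Mathlib

section
/- Let d_l ≥ 2, d_r ≥ 2 be integers and ε ∈ [0,1]. If the forward density evolution sequence x⁽⁰⁾ = 1, x⁽ℓ⁺¹⁾ = h_ε(x⁽ℓ⁾) converges to 0, where h_ε(x) = f_ε(p(x)^{d_l}) · p(x)^{d_l−1}, p(x) = 1 − (1−x)^{d_r−1}, and f_ε(y) = 4ε²/(2 − y(1−ε))², then for every x ∈ (0,1] one has ε² · (1 − (1−x)^{d_r−1})^{d_l−1} < x. -/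
/-- The DEC extrinsic transfer function `f_ε(y) = 4ε²/(2 − y(1−ε))²`. -/
noncomputable def decF (ε y : ℝ) : ℝ := 4 * ε ^ 2 / (2 - y * (1 - ε)) ^ 2

/-- `p(x) = 1 - (1-x)^(d_r - 1)`. -/
def decP (dr : ℕ) (x : ℝ) : ℝ := 1 - (1 - x) ^ (dr - 1)

/-- The joint-iterative-decoding density evolution map
`h_ε(x) = f_ε(p(x)^{d_l}) · p(x)^{d_l−1}`. -/
noncomputable def decH (dl dr : ℕ) (ε x : ℝ) : ℝ :=
  decF ε ((decP dr x) ^ dl) * (decP dr x) ^ (dl - 1)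

theorem decP_mem_Icc (dr : ℕ) {x : ℝ} (hx : x ∈ Set.Icc (0:ℝ) 1) :
    decP dr x ∈ Set.Icc (0:ℝ) 1 := by
  have h₀ : 0 ≤ (1 - x) ^ (dr - 1) := pow_nonneg (by linarith [hx.2]) _
  have h₁ : (1 - x) ^ (dr - 1) ≤ 1 := pow_le_one₀ (by linarith [hx.2]) (by linarith [hx.1])
  constructor <;> unfold decP <;> linarith

theorem decP_le_decP (dr : ℕ) {x y : ℝ} (hxy : x ≤ y) (hy : y ≤ 1) :
    decP dr x ≤ decP dr y := by
  have h : (1 - y) ^ (dr - 1) ≤ (1 - x) ^ (dr - 1) :=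
    pow_le_pow_left₀ (by linarith) (by linarith) _
  unfold decP
  linarith

theorem sq_le_decF {ε y : ℝ} (hε : ε ∈ Set.Icc (0:ℝ) 1) (hy : y ∈ Set.Icc (0:ℝ) 1) :
    ε ^ 2 ≤ decF ε y := by
  obtain ⟨hε₀, hε₁⟩ := hε
  obtain ⟨hy₀, hy₁⟩ := hy
  have h₀ : 0 ≤ y * (1 - ε) := mul_nonneg hy₀ (by linarith)
  have h₁ : y * (1 - ε) ≤ 1 - ε := mul_le_of_le_one_left (by linarith) hy₁
  have hsq : (2 - y * (1 - ε)) ^ 2 ≤ 2 ^ 2 := pow_le_pow_left₀ (by linarith) (by linarith) 2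
  unfold decF
  rw [le_div_iff₀ (pow_pos (by linarith) 2)]
  nlinarith [mul_le_mul_of_nonneg_left hsq (sq_nonneg ε)]

theorem decF_le_one {ε y : ℝ} (hε : ε ∈ Set.Icc (0:ℝ) 1) (hy : y ≤ 1) : decF ε y ≤ 1 := by
  obtain ⟨hε₀, hε₁⟩ := hε
  have h₁ : y * (1 - ε) ≤ 1 - ε := mul_le_of_le_one_left (by linarith) hy
  have hsq : (2 * ε) ^ 2 ≤ (2 - y * (1 - ε)) ^ 2 :=
    pow_le_pow_left₀ (by linarith) (by linarith) 2
  unfold decF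
  rw [div_le_one (pow_pos (by linarith) 2)]
  linarith

theorem decH_le_one (dl dr : ℕ) {ε x : ℝ} (hε : ε ∈ Set.Icc (0:ℝ) 1)
    (hx : x ∈ Set.Icc (0:ℝ) 1) : decH dl dr ε x ≤ 1 := by
  obtain ⟨hp₀, hp₁⟩ := decP_mem_Icc dr hx
  exact mul_le_one₀ (decF_le_one hε (pow_le_one₀ hp₀ hp₁)) (pow_nonneg hp₀ _)
    (pow_le_one₀ hp₀ hp₁)

theorem sq_mul_decP_pow_le_decH (dl dr : ℕ) {ε x : ℝ} (hε : ε ∈ Set.Icc (0:ℝ) 1)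
    (hx : x ∈ Set.Icc (0:ℝ) 1) : ε ^ 2 * decP dr x ^ (dl - 1) ≤ decH dl dr ε x := by
  obtain ⟨hp₀, hp₁⟩ := decP_mem_Icc dr hx
  exact mul_le_mul_of_nonneg_right
    (sq_le_decF hε ⟨pow_nonneg hp₀ _, pow_le_one₀ hp₀ hp₁⟩) (pow_nonneg hp₀ _)

/-- If forward density evolution `x⁰ = 1`, `x^{ℓ+1} = h_ε(x^ℓ)` converges to
`0`, then `ε² · (1 − (1−x)^{d_r−1})^{d_l−1} < x` for every `x ∈ (0,1]`. -/
theorem decH_success_implies_necessary_condition (dl dr : ℕ)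
    (hdl : 2 ≤ dl) (hdr : 2 ≤ dr)
    (ε : ℝ) (hε : ε ∈ Set.Icc (0:ℝ) 1)
    (x : ℕ → ℝ) (hx0 : x 0 = 1) (hxs : ∀ ℓ, x (ℓ + 1) = decH dl dr ε (x ℓ))
    (hconv : Filter.Tendsto x Filter.atTop (nhds 0)) :
    ∀ z ∈ Set.Ioc (0:ℝ) 1, ε ^ 2 * (1 - (1 - z) ^ (dr - 1)) ^ (dl - 1) < z := by
  rintro z ⟨hz₀, hz₁⟩
  by_contra! hz
  have hinv : ∀ ℓ, z ≤ x ℓ ∧ x ℓ ≤ 1 := by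
    intro ℓ
    induction ℓ with
    | zero => exact ⟨hx0 ▸ hz₁, hx0.le⟩
    | succ ℓ ih =>
      have hmem : x ℓ ∈ Set.Icc (0:ℝ) 1 := ⟨hz₀.le.trans ih.1, ih.2⟩
      rw [hxs]
      refine ⟨?_, decH_le_one dl dr hε hmem⟩
      calc z ≤ ε ^ 2 * decP dr z ^ (dl - 1) := hz
        _ ≤ ε ^ 2 * decP dr (x ℓ) ^ (dl - 1) :=
          mul_le_mul_of_nonneg_left
            (pow_le_pow_left₀ (decP_mem_Icc dr ⟨hz₀.le, hz₁⟩).1 (decP_le_decP dr ih.1 ih.2) _)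
            (sq_nonneg ε)
        _ ≤ decH dl dr ε (x ℓ) := sq_mul_decP_pow_le_decH dl dr hε hmem
  exact hz₀.not_ge (ge_of_tendsto' hconv fun ℓ => (hinv ℓ).1)
end

section
/- Let d_l ≥ 2, d_r ≥ 2 be integers with (d_l − 1)·e^{−√(d_r−1)} < 1, and let ε ∈ [0,1]. If ε² · (1 − (1−x)^{d_r−1})^{d_l−1} < x for all x ∈ (0,1], then ε ≤ √( 1 / ( √(d_r−1) · (1 − (d_l−1)·e^{−√(d_r−1)}) ) ). -/
/-- If `(d_l−1)·e^{−√(d_r−1)} < 1` and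
`ε² · (1 − (1−x)^{d_r−1})^{d_l−1} < x` for all `x ∈ (0,1]`, then
`ε ≤ √( 1 / ( √(d_r−1) · (1 − (d_l−1)·e^{−√(d_r−1)}) ) )`. -/
theorem jit_threshold_bound (dl dr : ℕ) (hdl : 2 ≤ dl) (hdr : 2 ≤ dr)
    (hsmall : ((dl : ℝ) - 1) * Real.exp (-Real.sqrt ((dr : ℝ) - 1)) < 1)
    (ε : ℝ) (hε : ε ∈ Set.Icc (0:ℝ) 1)
    (hnec : ∀ x ∈ Set.Ioc (0:ℝ) 1,
      ε ^ 2 * (1 - (1 - x) ^ (dr - 1)) ^ (dl - 1) < x) :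
    ε ≤ Real.sqrt (1 / (Real.sqrt ((dr : ℝ) - 1) *
      (1 - ((dl : ℝ) - 1) * Real.exp (-Real.sqrt ((dr : ℝ) - 1))))) := by
  obtain ⟨m, rfl⟩ : ∃ m, dl = m + 1 := ⟨dl - 1, by omega⟩
  obtain ⟨n, rfl⟩ : ∃ n, dr = n + 1 := ⟨dr - 1, by omega⟩
  have hn : (1 : ℝ) ≤ n := by exact_mod_cast (by omega : 1 ≤ n)
  simp only [Nat.cast_add, Nat.cast_one, add_sub_cancel_right, Nat.add_sub_cancel] at *
  set s := Real.sqrt (n : ℝ) with hs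
  have hs1 : 1 ≤ s := Real.one_le_sqrt.mpr hn
  have hs0 : 0 < s := by linarith
  have hss : s * s = n := Real.mul_self_sqrt (by linarith)
  have hx1 : s⁻¹ ≤ 1 := inv_le_one_of_one_le₀ hs1
  have hx0 : 0 < s⁻¹ := inv_pos.mpr hs0
  have key := hnec s⁻¹ ⟨hx0, hx1⟩
  have hpow_le : (1 - s⁻¹) ^ n ≤ Real.exp (-s) := by
    calc (1 - s⁻¹) ^ n ≤ Real.exp (-s⁻¹) ^ n :=
          pow_le_pow_left₀ (by linarith) (Real.one_sub_le_exp_neg _) n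
      _ = Real.exp (-s) := by
          rw [← Real.exp_nat_mul, ← hss]
          congr 1
          field_simp
  have hpow_le_one : (1 - s⁻¹) ^ n ≤ 1 := pow_le_one₀ (by linarith) (by linarith)
  have bernoulli : 1 - m * Real.exp (-s) ≤ (1 - (1 - s⁻¹) ^ n) ^ m := by
    have h := one_add_mul_le_pow (a := -(1 - s⁻¹) ^ n) (by linarith) m
    have h' := mul_le_mul_of_nonneg_left hpow_le (Nat.cast_nonneg (α := ℝ) m)
    rw [sub_eq_add_neg 1 ((1 - s⁻¹) ^ n)]
    linarith
  have hc : 0 < 1 - m * Real.exp (-s) := by linarith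
  apply Real.le_sqrt_of_sq_le
  rw [le_div_iff₀ (mul_pos hs0 hc)]
  have hle : ε ^ 2 * (1 - m * Real.exp (-s)) ≤ s⁻¹ :=
    (mul_le_mul_of_nonneg_left bernoulli (sq_nonneg ε)).trans key.le
  calc ε ^ 2 * (s * (1 - m * Real.exp (-s)))
      = s * (ε ^ 2 * (1 - m * Real.exp (-s))) := by ring
    _ ≤ s * s⁻¹ := mul_le_mul_of_nonneg_left hle hs0.le
    _ = 1 := mul_inv_cancel₀ hs0.ne'
end

section
/- Fix integers d_l ≥ 2, d_r ≥ 2, L ≥ 1, 1 ≤ w ≤ 2L, and ε ∈ [0,1]. Let T_ε be the coupled DEC density evolution map T_ε(x)_i = f_ε(A_i(x)^{d_l}) · A_i(x)^{d_l−1} and let S_ε be the coupled BEC density evolution map S_ε(x)_i = ε · A_i(x)^{d_l−1}, where A_i(x) = 1 − (1/w)·Σ_{j=0}^{w−1} (1 − (1/w)·Σ_{k=0}^{w−1} x_{i+j−k})^{d_r−1} (with x_i = 0 for |i| > L) and f_ε(y) = 4ε²/(2 − y(1−ε))². Then for the forward density evolution sequences x⁽⁰⁾ = y⁽⁰⁾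 = (1,…,1), x⁽ℓ⁺¹⁾ = T_ε(x⁽ℓ⁾), y⁽ℓ⁺¹⁾ = S_ε(y⁽ℓ⁾), one has x⁽ℓ⁾ ≤ y⁽ℓ⁾ coordinatewise for all ℓ ≥ 0; in particular, if the BEC iterates converge to 0 then so do the DEC iterates. -/
/-- `A_i(x) = 1 − (1/w)·Σ_{j<w} (1 − (1/w)·Σ_{k<w} x_{i+j−k})^{d_r−1}`. -/
noncomputable def coupledA (dr w : ℕ) (x : ℤ → ℝ) (i : ℤ) : ℝ :=
  1 - (1 / (w : ℝ)) * ∑ j ∈ Finset.range w,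
    (1 - (1 / (w : ℝ)) * ∑ k ∈ Finset.range w, x (i + (j : ℤ) - (k : ℤ))) ^ (dr - 1)

/-- The coupled DEC density evolution map
`T_ε(x)_i = f_ε(A_i(x)^{d_l}) · A_i(x)^{d_l−1}` for `i ∈ [−L,L]`, `0` outside. -/
noncomputable def coupledT (dl dr L w : ℕ) (ε : ℝ) (x : ℤ → ℝ) (i : ℤ) : ℝ :=
  if |i| ≤ (L : ℤ) then decF ε ((coupledA dr w x i) ^ dl) * (coupledA dr w x i) ^ (dl - 1)
  else 0

/-- The coupled BEC density evolution map
`S_ε(x)_i = ε · A_i(x)^{d_l−1}` for `i ∈ [−L,L]`, `0` outside. -/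
noncomputable def coupledS (dl dr L w : ℕ) (ε : ℝ) (x : ℤ → ℝ) (i : ℤ) : ℝ :=
  if |i| ≤ (L : ℤ) then ε * (coupledA dr w x i) ^ (dl - 1) else 0

open Finset in
lemma mean_range_mem_Icc {w : ℕ} (hw : 1 ≤ w) {a : ℕ → ℝ} (ha : ∀ j, a j ∈ Set.Icc (0 : ℝ) 1) :
    1 / (w : ℝ) * ∑ j ∈ range w, a j ∈ Set.Icc (0 : ℝ) 1 := by
  refine ⟨mul_nonneg (by positivity) (sum_nonneg fun j _ => (ha j).1), ?_⟩
  have hw' : (0 : ℝ) < w := by exact_mod_cast hw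
  have hsum : ∑ j ∈ range w, a j ≤ w := by
    simpa using sum_le_sum fun j (_ : j ∈ range w) => (ha j).2
  rw [one_div_mul_eq_div, div_le_one hw']
  exact hsum

lemma coupledA_mem_Icc {dr w : ℕ} (hw : 1 ≤ w) {x : ℤ → ℝ} (hx : ∀ i, x i ∈ Set.Icc (0 : ℝ) 1)
    (i : ℤ) : coupledA dr w x i ∈ Set.Icc (0 : ℝ) 1 := by
  unfold coupledA
  rw [← Set.Icc.mem_iff_one_sub_mem]
  refine mean_range_mem_Icc hw fun j => ?_
  have h := Set.Icc.mem_iff_one_sub_mem.1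
    (mean_range_mem_Icc hw fun k : ℕ => hx (i + (j : ℤ) - (k : ℤ)))
  exact ⟨pow_nonneg h.1 _, pow_le_one₀ h.1 h.2⟩

lemma coupledA_le_coupledA {dr w : ℕ} (hw : 1 ≤ w) {x y : ℤ → ℝ}
    (hy : ∀ i, y i ∈ Set.Icc (0 : ℝ) 1) (hxy : ∀ i, x i ≤ y i) (i : ℤ) :
    coupledA dr w x i ≤ coupledA dr w y i := by
  unfold coupledA
  gcongr with j _ k _
  · exact (Set.Icc.mem_iff_one_sub_mem.1
      (mean_range_mem_Icc hw fun k : ℕ => hy (i + (j : ℤ) - (k : ℤ)))).1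
  · exact hxy _

lemma decF_nonneg (ε y : ℝ) : 0 ≤ decF ε y := by
  unfold decF
  positivity

lemma decF_le {ε y : ℝ} (hε : ε ∈ Set.Icc (0 : ℝ) 1) (hy : y ≤ 1) : decF ε y ≤ ε := by
  obtain ⟨h0, h1⟩ := hε
  have hden : 1 + ε ≤ 2 - y * (1 - ε) := by nlinarith
  have hsq : 4 * ε ≤ (2 - y * (1 - ε)) ^ 2 := by nlinarith [sq_nonneg (1 - ε)]
  unfold decF
  rw [div_le_iff₀ (by nlinarith)]
  nlinarith [mul_le_mul_of_nonneg_left hsq h0]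

lemma coupledT_nonneg {dl dr L w : ℕ} {ε : ℝ} (hw : 1 ≤ w) {x : ℤ → ℝ}
    (hx : ∀ i, x i ∈ Set.Icc (0 : ℝ) 1) (i : ℤ) : 0 ≤ coupledT dl dr L w ε x i := by
  unfold coupledT
  split_ifs
  · exact mul_nonneg (decF_nonneg _ _) (pow_nonneg (coupledA_mem_Icc hw hx i).1 _)
  · exact le_rfl

lemma coupledS_mem_Icc {dl dr L w : ℕ} {ε : ℝ} (hε : ε ∈ Set.Icc (0 : ℝ) 1) (hw : 1 ≤ w)
    {y : ℤ → ℝ} (hy : ∀ i, y i ∈ Set.Icc (0 : ℝ) 1) (i : ℤ) :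
    coupledS dl dr L w ε y i ∈ Set.Icc (0 : ℝ) 1 := by
  obtain ⟨h0, h1⟩ := coupledA_mem_Icc (dr := dr) hw hy i
  unfold coupledS
  split_ifs
  · exact ⟨mul_nonneg hε.1 (pow_nonneg h0 _),
      mul_le_one₀ hε.2 (pow_nonneg h0 _) (pow_le_one₀ h0 h1)⟩
  · exact ⟨le_rfl, zero_le_one⟩

lemma coupledT_le_coupledS {dl dr L w : ℕ} {ε : ℝ} (hε : ε ∈ Set.Icc (0 : ℝ) 1) (hw : 1 ≤ w)
    {x y : ℤ → ℝ} (hx : ∀ i, x i ∈ Set.Icc (0 : ℝ) 1) (hy : ∀ i, y i ∈ Set.Icc (0 : ℝ) 1)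
    (hxy : ∀ i, x i ≤ y i) (i : ℤ) :
    coupledT dl dr L w ε x i ≤ coupledS dl dr L w ε y i := by
  obtain ⟨h0, h1⟩ := coupledA_mem_Icc (dr := dr) hw hx i
  unfold coupledT coupledS
  split_ifs
  · exact mul_le_mul (decF_le hε (pow_le_one₀ h0 h1))
      (pow_le_pow_left₀ h0 (coupledA_le_coupledA hw hy hxy i) _) (pow_nonneg h0 _) hε.1
  · exact le_rfl

/-- Forward density evolution over the DEC is dominated coordinatewise by
forward density evolution over the BEC; in particular, if the BEC iterates
converge to `0` then so do the DEC iterates. -/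
theorem coupled_DEC_dominated_by_BEC (dl dr L w : ℕ)
    (hdl : 2 ≤ dl) (hdr : 2 ≤ dr) (hL : 1 ≤ L) (hw1 : 1 ≤ w) (hw2 : w ≤ 2 * L)
    (ε : ℝ) (hε : ε ∈ Set.Icc (0:ℝ) 1)
    (x y : ℕ → ℤ → ℝ)
    (hx0 : x 0 = fun i => if |i| ≤ (L : ℤ) then (1:ℝ) else 0)
    (hy0 : y 0 = fun i => if |i| ≤ (L : ℤ) then (1:ℝ) else 0)
    (hxs : ∀ ℓ, x (ℓ + 1) = coupledT dl dr L w ε (x ℓ))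
    (hys : ∀ ℓ, y (ℓ + 1) = coupledS dl dr L w ε (y ℓ)) :
    (∀ ℓ i, x ℓ i ≤ y ℓ i) ∧
    ((∀ i, Filter.Tendsto (fun ℓ => y ℓ i) Filter.atTop (nhds 0)) →
      ∀ i, Filter.Tendsto (fun ℓ => x ℓ i) Filter.atTop (nhds 0)) := by
  have key : ∀ ℓ i, 0 ≤ x ℓ i ∧ x ℓ i ≤ y ℓ i ∧ y ℓ i ≤ 1 := by
    intro ℓ
    induction ℓ with
    | zero =>
      intro i
      rw [hx0, hy0]
      dsimp only
      split_ifs <;> norm_num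
    | succ ℓ ih =>
      intro i
      have hx : ∀ i, x ℓ i ∈ Set.Icc (0 : ℝ) 1 := fun i =>
        ⟨(ih i).1, (ih i).2.1.trans (ih i).2.2⟩
      have hy : ∀ i, y ℓ i ∈ Set.Icc (0 : ℝ) 1 := fun i =>
        ⟨(ih i).1.trans (ih i).2.1, (ih i).2.2⟩
      rw [hxs, hys]
      exact ⟨coupledT_nonneg hw1 hx i, coupledT_le_coupledS hε hw1 hx hy (fun i => (ih i).2.1) i,
        (coupledS_mem_Icc hε hw1 hy i).2⟩
  exact ⟨fun ℓ i => (key ℓ i).2.1, fun h i =>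
    squeeze_zero (fun ℓ => (key ℓ i).1) (fun ℓ => (key ℓ i).2.1) (h i)⟩
end
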